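/- For every real t ∈ [0,1]: min(t, 1−t) ≥ (H₂(t))^{ln 4} / 4, where ln 4 denotes the natural logarithm of 4. -/

import Mathlib

/-- Binary entropy (base 2), with the convention `0 * log 0 = 0`
(automatic since `Real.logb 2 0 = 0`). -/
noncomputable def H2 (t : ℝ) : ℝ :=
  -(t * Real.logb 2 t) - (1 - t) * Real.logb 2 (1 - t)

theorem H2_one_sub (t : ℝ) : H2 (1 - t) = H2 t := by
  unfold H2
  ring_nf

theorem H2_nonneg {t : ℝ} (h0 : 0 ≤ t) (h1 : t ≤ 1) : 0 ≤ H2 t := by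
  have h2 : 0 < Real.log 2 := Real.log_pos (by norm_num)
  have hl := mul_nonneg h0 (neg_nonneg.2 (Real.log_nonpos h0 h1))
  have hr := mul_nonneg (sub_nonneg.2 h1)
    (neg_nonneg.2 (Real.log_nonpos (sub_nonneg.2 h1) (by linarith)))
  have : H2 t = (t * -Real.log t + (1 - t) * -Real.log (1 - t)) / Real.log 2 := by
    unfold H2 Real.logb
    ring
  rw [this]
  positivity

/-- The elementary bound `-(1 - t) log (1 - t) ≤ t` turns the entropy into a function of `log t`. -/
theorem H2_mul_log_two_le {t : ℝ} (h1 : t ≤ 1) :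
    H2 t * Real.log 2 ≤ t * (1 - Real.log t) := by
  have h2 : 0 < Real.log 2 := Real.log_pos (by norm_num)
  have hH : H2 t * Real.log 2 = -(t * Real.log t) - (1 - t) * Real.log (1 - t) := by
    unfold H2 Real.logb
    field_simp
  have key : -t ≤ (1 - t) * Real.log (1 - t) := by
    rcases h1.eq_or_lt with rfl | h
    · simp
    · have hp : 0 < 1 - t := by linarith
      have := mul_le_mul_of_nonneg_left (Real.one_sub_inv_le_log_of_pos hp) hp.le
      rw [mul_sub, mul_inv_cancel₀ hp.ne'] at this
      linarith
  rw [hH]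
  linarith

theorem one_le_log_two_sub_half_mul_exp :
    1 ≤ (Real.log 2 - 1 / 2) * Real.exp (1 + 1 / Real.log 4) := by
  have hlb := Real.log_two_gt_d9
  have hub := Real.log_two_lt_d9
  have h4 : Real.log 4 = 2 * Real.log 2 := by
    rw [show (4 : ℝ) = 2 ^ 2 by norm_num, Real.log_pow]
    norm_num
  have hc : 0.72 ≤ 1 / Real.log 4 := by
    rw [h4, le_div_iff₀ (by linarith)]
    linarith
  have he : 1.97 ≤ Real.exp (1 / Real.log 4) := by
    have := Real.quadratic_le_exp_of_nonneg (show 0 ≤ 1 / Real.log 4 by linarith)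
    nlinarith
  have he1 := Real.exp_one_gt_d9
  rw [Real.exp_add]
  have hprod : 2.71 * 1.97 ≤ Real.exp 1 * Real.exp (1 / Real.log 4) :=
    mul_le_mul (by linarith) he (by norm_num) (by positivity)
  nlinarith

theorem H2_le_exp {t : ℝ} (h0 : 0 < t) (h1 : t ≤ 1) :
    H2 t ≤ Real.exp (1 + Real.log t / Real.log 4) := by
  have hlb := Real.log_two_gt_d9
  have h4 : Real.log 4 = 2 * Real.log 2 := by
    rw [show (4 : ℝ) = 2 ^ 2 by norm_num, Real.log_pow]
    norm_num
  set c := 1 / Real.log 4 with hc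
  have hcl : c * Real.log 2 = 1 / 2 := by
    rw [hc, h4]
    field_simp
  set x := 1 - Real.log t with hx
  have hconst : 1 ≤ (1 - c) * Real.log 2 * Real.exp (1 + c) := by
    have := one_le_log_two_sub_half_mul_exp
    rwa [← hcl, ← one_sub_mul] at this
  have htan : (1 - c) * x ≤ Real.exp ((1 - c) * x - 1) := by
    linarith [Real.add_one_le_exp ((1 - c) * x - 1)]
  have hac : 0 < 1 - c := by nlinarith
  have hexp : t * Real.exp ((1 - c) * x - 1) * Real.exp (1 + c)
      = Real.exp (1 + Real.log t / Real.log 4) := by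
    nth_rewrite 1 [← Real.exp_log h0]
    rw [← Real.exp_add, ← Real.exp_add, div_eq_mul_one_div, ← hc, hx]
    congr 1
    ring
  have hH := H2_mul_log_two_le h1
  have hpos : 0 < (1 - c) * Real.log 2 := by positivity
  refine le_of_mul_le_mul_left ?_ hpos
  calc (1 - c) * Real.log 2 * H2 t = (1 - c) * (H2 t * Real.log 2) := by ring
    _ ≤ (1 - c) * (t * x) := by gcongr
    _ = t * ((1 - c) * x) := by ring
    _ ≤ t * Real.exp ((1 - c) * x - 1) := by gcongr
    _ ≤ t * Real.exp ((1 - c) * x - 1) * ((1 - c) * Real.log 2 * Real.exp (1 + c)) :=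
      le_mul_of_one_le_right (by positivity) hconst
    _ = (1 - c) * Real.log 2 * Real.exp (1 + Real.log t / Real.log 4) := by
      rw [← hexp]
      ring

theorem H2_rpow_log_four_le {t : ℝ} (h0 : 0 ≤ t) (h1 : t ≤ 1) :
    H2 t ^ Real.log 4 ≤ 4 * t := by
  have hl : 0 < Real.log 4 := Real.log_pos (by norm_num)
  rcases h0.eq_or_lt with rfl | hpos
  · simp [H2, Real.zero_rpow hl.ne']
  · calc H2 t ^ Real.log 4 ≤ Real.exp (1 + Real.log t / Real.log 4) ^ Real.log 4 :=
        Real.rpow_le_rpow (H2_nonneg h0 h1) (H2_le_exp hpos h1) hl.le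
      _ = Real.exp (Real.log 4 + Real.log t) := by
        rw [← Real.exp_mul]
        congr 1
        field_simp
      _ = 4 * t := by
        rw [Real.exp_add, Real.exp_log hpos, Real.exp_log (by norm_num)]

/-- For every `t ∈ [0,1]`: `min(t, 1−t) ≥ (H₂(t))^(ln 4) / 4`,
where `ln 4` is the natural logarithm of `4`. -/
theorem min_ge_entropy_rpow
    (t : ℝ) (ht : t ∈ Set.Icc (0 : ℝ) 1) :
    H2 t ^ Real.log 4 / 4 ≤ min t (1 - t) := by
  have hl := H2_rpow_log_four_le ht.1 ht.2
  have hr := H2_rpow_log_four_le (sub_nonneg.2 ht.2) (sub_le_self 1 ht.1)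
  rw [H2_one_sub] at hr
  exact le_min (by linarith) (by linarith)
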